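/- arXiv:1503.05021 — 2 statements merged into one kernel-verified Lean document; each statement's English description precedes it below -/
import Mathlib

section
/- Let k be a number field with ring of integers O_k, let p and q be positive integers, and let α ∈ O_k be nonzero. Then there exists a nonzero integer β ∈ ℤ such that: (1) no nonzero prime ideal of O_k contains both α and β; (2) there is a nonzero prime ideal 𝔟 of O_k such that β ∈ 𝔟 but β ∉ 𝔟²; (3) for every nonzero prime ideal 𝔭 of O_k containing α·q, the element β is a q-th power in the 𝔭-adic completion k_𝔭; and (4) for every nonzero prime ideal 𝔭 of O_k containing β, the element α is a p-th power in the 𝔭-adic completion k_𝔭. -/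
open IsDedekindDomain NumberField

open Polynomial in
theorem aux_qth_power {R : Type*} [CommRing R] [HenselianLocalRing R] (q : ℕ) (hq : 0 < q)
    (s : R) (hs : s ∈ IsLocalRing.maximalIdeal R) :
    ∃ y : R, y ^ q = 1 + (q : R) ^ 2 * s := by
  nontriviality R
  obtain ⟨n, rfl⟩ : ∃ n, q = n + 1 := ⟨q - 1, by omega⟩
  set Q : R := ((n + 1 : ℕ) : R) with hQ
  let G : R[X] := ∑ i ∈ Finset.range n,
    C (Q ^ i * s ^ i * ((n + 1).choose (i + 2) : R)) * X ^ (n - 1 - i)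
  let F : R[X] := X ^ (n + 1) + (- X ^ n - C s * G)
  have hGdeg : G.degree < ((n + 1 : ℕ) : WithBot ℕ) := by
    refine lt_of_le_of_lt (degree_sum_le _ _) ?_
    rw [Finset.sup_lt_iff (by exact WithBot.bot_lt_coe _)]
    intro i hi
    refine lt_of_le_of_lt (degree_C_mul_X_pow_le _ _) ?_
    exact_mod_cast (by omega)
  have hF : F.Monic := by
    apply monic_X_pow_add
    refine lt_of_le_of_lt (degree_sub_le _ _) (max_lt ?_ ?_)
    · rw [degree_neg, degree_X_pow]
      exact_mod_cast Nat.lt_succ_self n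
    · refine lt_of_le_of_lt ?_ hGdeg
      rw [← smul_eq_C_mul]
      exact degree_smul_le _ _
  have key : ∀ x : R, (x + Q * s) ^ (n + 1)
      = x ^ (n + 1) * (1 + Q ^ 2 * s) - Q ^ 2 * s * F.eval x := by
    intro x
    have hG : Q ^ 2 * s ^ 2 * G.eval x =
        ∑ i ∈ Finset.range n, (Q * s) ^ (i + 2) * x ^ (n - 1 - i) * ((n + 1).choose (i + 2) : R) := by
      simp only [G, eval_finsetSum, eval_mul, eval_C, eval_pow, eval_X, Finset.mul_sum]
      refine Finset.sum_congr rfl fun i _ => by ring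
    have : (x + Q * s) ^ (n + 1) =
        x ^ (n + 1) + Q * s * x ^ n * Q + Q ^ 2 * s ^ 2 * G.eval x := by
      rw [hG, add_comm x, add_pow, Finset.sum_range_succ', Finset.sum_range_succ']
      have : ∀ i, n + 1 - (i + 1 + 1) = n - 1 - i := fun i => by omega
      simp only [this]
      simp [hQ]
      ring
    rw [this]
    simp only [F, eval_add, eval_sub, eval_neg, eval_mul, eval_C, eval_pow, eval_X]
    ring
  obtain ⟨x, hx, hx1⟩ := HenselianLocalRing.is_henselian F hF 1 (by
      simp only [F, eval_add, eval_sub, eval_neg, eval_mul, eval_C, eval_pow, eval_X, one_pow]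
      have : (1 : R) + (-1 - s * eval 1 G) = s * (- eval 1 G) := by ring
      rw [this]
      exact Ideal.mul_mem_right _ _ hs) (by
      have : eval 1 (derivative F) = 1 - s * eval 1 (derivative G) := by
        simp [F, derivative_X_pow]; ring
      rw [this]
      by_contra hu
      have h2 : 1 - s * eval 1 (derivative G) ∈ IsLocalRing.maximalIdeal R := hu
      have := Ideal.add_mem _ h2 (Ideal.mul_mem_right (eval 1 (derivative G)) _ hs)
      rw [sub_add_cancel] at this
      exact (Ideal.ne_top_iff_one _).1 (Ideal.IsPrime.ne_top inferInstance) this)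
  have hxu : IsUnit x := by
    by_contra hu
    have h2 : x ∈ IsLocalRing.maximalIdeal R := hu
    have := Ideal.sub_mem _ h2 hx1
    rw [sub_sub_cancel] at this
    exact (Ideal.ne_top_iff_one _).1 (Ideal.IsPrime.ne_top inferInstance) this
  obtain ⟨u, rfl⟩ := hxu
  refine ⟨(u + Q * s) * (↑u⁻¹ : R), ?_⟩
  rw [mul_pow, key, hx.eq_zero]
  have : (u : R) ^ (n+1) * (↑u⁻¹ : R) ^ (n+1) = 1 := by rw [← mul_pow]; simp
  linear_combination (1 + Q ^ 2 * s) * this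

open Polynomial in
theorem aux_pth_power {R : Type*} [CommRing R] [HenselianLocalRing R] (p : ℕ) (hp : 0 < p)
    (hpu : IsUnit (p : R)) (a b : R) (ha : IsUnit a)
    (h : b ^ p - a ∈ IsLocalRing.maximalIdeal R) :
    ∃ y : R, y ^ p = a := by
  have hb : IsUnit b := by
    by_contra hu
    have h2 : b ∈ IsLocalRing.maximalIdeal R := hu
    have := Ideal.sub_mem _ (Ideal.pow_mem_of_mem _ h2 p hp) h
    rw [sub_sub_cancel] at this
    exact this ha
  obtain ⟨y, hy, -⟩ := HenselianLocalRing.is_henselian (X ^ p - C a)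
    (monic_X_pow_sub_C a hp.ne') b (by simpa using h) (by
      simp only [derivative_sub, derivative_X_pow, derivative_C, sub_zero, eval_mul, eval_pow,
        eval_X, eval_natCast, map_natCast]
      exact hpu.mul (hb.pow _))
  exact ⟨y, by simpa [sub_eq_zero] using hy⟩

theorem aux_adicComplete (k : Type*) [Field k] [NumberField k] (v : HeightOneSpectrum (𝓞 k)) :
    IsAdicComplete (IsLocalRing.maximalIdeal (v.adicCompletionIntegers k))
      (v.adicCompletionIntegers k) := by
  have hcl : IsClosed ((v.adicCompletionIntegers k : Set (v.adicCompletion k))) :=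
    Valued.isClosed_valuationSubring _
  have hop : IsOpen ((v.adicCompletionIntegers k : Set (v.adicCompletion k))) :=
    Valued.isOpen_valuationSubring _
  have : CompleteSpace (v.adicCompletionIntegers k) := hcl.completeSpace_coe
  obtain ⟨π, hπ⟩ := IsDiscreteValuationRing.exists_irreducible (v.adicCompletionIntegers k)
  have hm := hπ.maximalIdeal_eq
  have hadic : IsAdic (IsLocalRing.maximalIdeal (v.adicCompletionIntegers k)) := by
    rw [isAdic_iff, hm]
    have hπ0 : (π : v.adicCompletion k) ≠ 0 := fun h => hπ.ne_zero (Subtype.ext h)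
    have hmem : ∀ (n : ℕ) (x : v.adicCompletionIntegers k), x ∈ Ideal.span {π} ^ n ↔
        ((π : v.adicCompletion k) ^ n)⁻¹ * x ∈ v.adicCompletionIntegers k := by
      intro n x
      rw [Ideal.span_singleton_pow, Ideal.mem_span_singleton]
      constructor
      · rintro ⟨c, rfl⟩
        have : ((π : v.adicCompletion k) ^ n)⁻¹ * ((π ^ n * c : v.adicCompletionIntegers k) :
          v.adicCompletion k) = c := by
          push_cast
          field_simp
        rw [this]
        exact c.2
      · intro h
        refine ⟨⟨_, h⟩, Subtype.ext ?_⟩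
        push_cast
        field_simp
    constructor
    · intro n
      have : ((Ideal.span {π} ^ n : Ideal (v.adicCompletionIntegers k)) :
          Set (v.adicCompletionIntegers k)) = (fun x : v.adicCompletionIntegers k =>
          ((π : v.adicCompletion k) ^ n)⁻¹ * (x : v.adicCompletion k)) ⁻¹'
            (v.adicCompletionIntegers k : Set (v.adicCompletion k)) := by
        ext x
        exact hmem n x
      rw [this]
      exact hop.preimage (continuous_const.mul continuous_subtype_val)
    · intro s hs
      rw [nhds_induced, Filter.mem_comap] at hs
      obtain ⟨t, ht, hts⟩ := hs
      rw [ZeroMemClass.coe_zero, Valued.mem_nhds_zero] at ht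
      obtain ⟨γ, hγ⟩ := ht
      have hπ1 : Valued.v.restrict (π : v.adicCompletion k) < 1 := by
        rw [Valuation.restrict_lt_one_iff]
        have := hπ.not_isUnit
        rw [HeightOneSpectrum.adicCompletionIntegers.isUnit_iff_valued_eq_one] at this
        exact lt_of_le_of_ne π.2 this
      obtain ⟨n, hn⟩ := exists_pow_lt₀ hπ1 γ
      refine ⟨n, fun x hx => hts (hγ ?_)⟩
      have hx' := (hmem n x).1 hx
      rw [HeightOneSpectrum.mem_adicCompletionIntegers, ← Valuation.restrict_le_one_iff] at hx'
      have : (x : v.adicCompletion k) = π ^ n * (((π : v.adicCompletion k) ^ n)⁻¹ * x) := by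
        field_simp
      change Valued.v.restrict (x : v.adicCompletion k) < γ
      rw [this, map_mul, map_pow]
      exact lt_of_le_of_lt (mul_le_of_le_one_right' hx') hn
  exact hadic.isAdicComplete_iff.2 ⟨inferInstance, inferInstance⟩

theorem aux_hens (k : Type*) [Field k] [NumberField k] (v : HeightOneSpectrum (𝓞 k)) :
    HenselianLocalRing (v.adicCompletionIntegers k) where
  is_henselian := by
    intro f hf a h1 h2
    have := aux_adicComplete k v
    exact HenselianRing.is_henselian f hf a h1 (h2.map _)

open Polynomial in
/-- Schur: a nonconstant integer polynomial has roots modulo arbitrarily large primes. -/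
theorem aux_schur (f : ℤ[X]) (hf : 0 < f.natDegree) (B : ℕ) :
    ∃ l : ℕ, l.Prime ∧ B < l ∧ ∃ n : ℤ, (l : ℤ) ∣ f.eval n := by
  by_cases hc : f.eval 0 = 0
  · obtain ⟨l, hl, hp⟩ := Nat.exists_infinite_primes (B + 1)
    exact ⟨l, hp, hl, 0, by simp [hc]⟩
  set c := f.eval 0 with hcdef
  -- avoid the finitely many `t` with value `± c`
  let w : ℤ := c * (B.factorial : ℤ)
  have hw : w ≠ 0 := mul_ne_zero hc (by exact_mod_cast B.factorial_ne_zero)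
  have hfin : ∀ a : ℤ, Set.Finite {t : ℤ | f.eval (w * t) = a} := by
    intro a
    have h0 : f - C a ≠ 0 := by
      intro h
      rw [sub_eq_zero] at h
      rw [h, natDegree_C] at hf
      exact lt_irrefl _ hf
    have := (f - C a).roots.toFinset.finite_toSet.preimage
      (f := fun t : ℤ => w * t) (fun x _ y _ h => mul_left_cancel₀ hw h)
    refine this.subset fun t ht => ?_
    simp only [Set.mem_ofPred_eq] at ht
    rw [Set.mem_preimage, Finset.mem_coe, Multiset.mem_toFinset, mem_roots h0, IsRoot.def,
      eval_sub, eval_C, ht, sub_self]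
  obtain ⟨t, ht⟩ := ((hfin c).union (hfin (-c))).exists_notMem
  simp only [Set.mem_union, Set.mem_ofPred_eq, not_or] at ht
  have hdvd : w ∣ f.eval (w * t) - c := by
    have := sub_dvd_eval_sub (w * t) 0 f
    rw [sub_zero] at this
    exact (Dvd.intro _ rfl).trans this
  obtain ⟨r, hr⟩ := hdvd
  have hval : f.eval (w * t) = c * (1 + B.factorial * r) := by
    simp only [w] at hr
    linear_combination hr
  set g : ℤ := 1 + B.factorial * r with hg
  have hg1 : g.natAbs ≠ 1 := by
    intro h
    rcases Int.natAbs_eq_iff.1 h with h | h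
    · exact ht.1 (by rw [hval, h]; simp)
    · exact ht.2 (by rw [hval, h]; simp)
  obtain ⟨l, hl, hlg⟩ := Nat.exists_prime_and_dvd hg1
  have hlg' : (l : ℤ) ∣ g := Int.natCast_dvd.2 hlg
  refine ⟨l, hl, ?_, w * t, hval ▸ hlg'.mul_left c⟩
  by_contra hB
  have h1 : (l : ℤ) ∣ B.factorial := by
    exact_mod_cast (hl.dvd_factorial).2 (not_lt.1 hB)
  have h2 : (l : ℤ) ∣ 1 := by
    have := dvd_sub hlg' (h1.mul_right r)
    rwa [hg, add_sub_cancel_right] at this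
  exact hl.one_lt.ne' (by exact_mod_cast Int.eq_one_of_dvd_one (by positivity) h2)

open Polynomial in
theorem aux_galois (N : Type*) [Field N] [NumberField N] [IsGalois ℚ N] (B : ℕ) :
    ∃ l : ℕ, l.Prime ∧ B < l ∧ ∀ P : Ideal (𝓞 N), P.IsPrime → (l : 𝓞 N) ∈ P →
      ∀ x : 𝓞 N, ∃ m : ℤ, x - m ∈ P := by
  obtain ⟨θ₀, hθ₀⟩ := Field.exists_primitive_element ℚ N
  obtain ⟨y, hy0, hy⟩ := ((IsFractionRing.isAlgebraic_iff ℤ ℚ N).2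
    (Algebra.IsAlgebraic.isAlgebraic (R := ℚ) θ₀)).exists_integral_multiple
  set θ : N := y • θ₀ with hθdef
  have hθ : IntermediateField.adjoin ℚ {θ} = ⊤ := by
    rw [eq_top_iff, ← hθ₀, IntermediateField.adjoin_simple_le_iff]
    have h1 : θ ∈ IntermediateField.adjoin ℚ {θ} := IntermediateField.mem_adjoin_simple_self _ _
    have : θ₀ = ((y : ℚ)⁻¹) • θ := by
      rw [hθdef, zsmul_eq_mul, Algebra.smul_def]
      have : (y : N) ≠ 0 := by exact_mod_cast hy0
      simp
      field_simp
    rw [this]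
    exact IntermediateField.smul_mem _ h1
  let pb : PowerBasis ℚ N := PowerBasis.ofAdjoinEqTop' (hy.tower_top) (by
    rw [← IntermediateField.adjoin_simple_toSubalgebra_of_isAlgebraic
      (Algebra.IsAlgebraic.isAlgebraic _), hθ]; rfl)
  have hgen : pb.gen = θ := by simp [pb]
  have hint : IsIntegral ℤ pb.gen := hgen ▸ hy
  have hdint : IsIntegral ℤ (Algebra.discr ℚ pb.basis) := by
    apply Algebra.discr_isIntegral
    intro i
    rw [pb.basis_eq_pow]
    exact hint.pow _
  obtain ⟨d, hd⟩ := IsIntegrallyClosed.isIntegral_iff.1 hdint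
  have hd0 : d ≠ 0 := by
    rintro rfl
    exact Algebra.discr_not_zero_of_basis ℚ pb.basis (by simpa using hd.symm)
  -- every integer times `d` is polynomial in θ
  have hpoly : ∀ x : 𝓞 N, ∃ g : ℤ[X], (d : N) * x = aeval θ g := by
    intro x
    have := Algebra.discr_mul_isIntegral_mem_adjoin (R := ℤ) ℚ hint x.isIntegral_coe
    rw [Algebra.adjoin_singleton_eq_range_aeval, hgen, ← hd] at this
    obtain ⟨g, hg⟩ := this
    refine ⟨g, ?_⟩
    rw [Algebra.smul_def] at hg
    have hg' : aeval θ g = algebraMap ℚ N (algebraMap ℤ ℚ d) * (x : N) := hg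
    rw [hg']
    simp
  let Θ : 𝓞 N := ⟨θ, hy⟩
  let f : ℤ[X] := LinearMap.charpoly (Algebra.lmul ℤ (𝓞 N) Θ)
  have hfdeg : 0 < f.natDegree := by
    rw [LinearMap.charpoly_natDegree]
    exact Module.finrank_pos
  have hfeval : ∀ n : ℤ, f.eval n = Algebra.norm ℤ ((n : 𝓞 N) - Θ) := by
    intro n
    rw [LinearMap.eval_charpoly, Algebra.norm_apply]
    refine congrArg LinearMap.det ?_
    ext x
    simp [sub_mul]
  obtain ⟨l, hl, hlB, n, hn⟩ := aux_schur f hfdeg (max B d.natAbs)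
  refine ⟨l, hl, (le_max_left _ _).trans_lt hlB, fun P hP hlP x => ?_⟩
  have hld : IsCoprime (l : ℤ) d := by
    rw [Int.isCoprime_iff_gcd_eq_one, Int.gcd, Int.natAbs_natCast]
    refine (hl.coprime_iff_not_dvd).2 fun h => ?_
    have := Nat.le_of_dvd (Int.natAbs_pos.2 hd0) h
    exact absurd ((le_max_right _ _).trans_lt hlB) (not_lt.2 this)
  -- product over the Galois group
  have hroot : ∃ σ : N ≃ₐ[ℚ] N, ∃ z : 𝓞 N, (z : N) = σ θ ∧ (n : 𝓞 N) - z ∈ P := by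
    have h1 : (∏ σ : Gal(N/ℚ), galRestrict ℤ ℚ N (𝓞 N) σ ((n : 𝓞 N) - Θ)) =
        ((Algebra.norm ℤ ((n : 𝓞 N) - Θ) : ℤ) : 𝓞 N) := by
      apply RingOfIntegers.coe_injective
      have h7 := Algebra.norm_eq_prod_automorphisms ℚ (((n : 𝓞 N) - Θ : 𝓞 N) : N)
      rw [← Algebra.coe_norm_int] at h7
      rw [map_prod]
      simp only [algebraMap_galRestrict_apply]
      rw [← h7]
      simp
    have h2 : ∏ σ : Gal(N/ℚ), galRestrict ℤ ℚ N (𝓞 N) σ ((n : 𝓞 N) - Θ) ∈ P := by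
      rw [h1, ← hfeval]
      obtain ⟨r, hr⟩ := hn
      rw [hr]
      push_cast
      exact P.mul_mem_right _ hlP
    rw [hP.prod_mem_iff] at h2
    obtain ⟨σ, -, hσ⟩ := h2
    refine ⟨σ, galRestrict ℤ ℚ N (𝓞 N) σ Θ, algebraMap_galRestrict_apply ℤ σ Θ, ?_⟩
    simpa using hσ
  obtain ⟨σ, z, hz, hzP⟩ := hroot
  obtain ⟨g, hg⟩ := hpoly (RingOfIntegers.mapRingEquiv σ.symm.toRingEquiv x)
  have hgz : (d : 𝓞 N) * x = aeval z g := by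
    apply RingOfIntegers.coe_injective
    have h4 := congrArg σ hg
    have h5 : ((aeval z g : 𝓞 N) : N) = aeval (z : N) g :=
      (aeval_algebraMap_apply N z g).symm
    have h6 : σ (aeval θ g) = aeval (σ θ) g := (aeval_algHom_apply
      ((σ : N →ₐ[ℚ] N).restrictScalars ℤ) θ g).symm
    refine Eq.trans ?_ h5.symm
    rw [hz, ← h6, ← h4]
    simp
  obtain ⟨a, b, hab⟩ := hld
  refine ⟨b * g.eval n, ?_⟩
  have h1 : aeval z g - ((g.eval n : ℤ) : 𝓞 N) ∈ P := by
    have h2 : ((g.eval n : ℤ) : 𝓞 N) = aeval (n : 𝓞 N) g := by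
      simpa using (Polynomial.aeval_algebraMap_apply (𝓞 N) n g).symm
    rw [h2]
    have h3 : z - (n : 𝓞 N) ∣ aeval z g - aeval (n : 𝓞 N) g := by
      simpa [aeval_def, eval₂_eq_eval_map] using
        sub_dvd_eval_sub z (n : 𝓞 N) (g.map (algebraMap ℤ (𝓞 N)))
    refine P.mem_of_dvd h3 ?_
    rw [← neg_sub]
    exact P.neg_mem hzP
  have hab' : (a : 𝓞 N) * l + b * d = 1 := by exact_mod_cast congrArg (Int.cast (R := 𝓞 N)) hab
  have : x - ((b * g.eval n : ℤ) : 𝓞 N)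
      = a * x * l + b * (aeval z g - ((g.eval n : ℤ) : 𝓞 N)) := by
    rw [← hgz]; push_cast
    linear_combination (-x) * hab'
  rw [this]
  exact P.add_mem (P.mul_mem_left _ hlP) (P.mul_mem_left _ h1)

theorem aux_descend (K L : Type*) [Field K] [NumberField K] [Field L] [NumberField L] [Algebra K L]
    (v : Ideal (𝓞 K)) (hv : v.IsPrime) :
    ∃ P : Ideal (𝓞 L), P.IsPrime ∧ P.comap (algebraMap (𝓞 K) (𝓞 L)) = v := by
  obtain ⟨Q, -, hQ, hQv⟩ := Ideal.exists_ideal_over_prime_of_isIntegral (S := 𝓞 L) v ⊥ (by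
    rw [← RingHom.ker_eq_comap_bot, (RingHom.injective_iff_ker_eq_bot _).1
      (FaithfulSMul.algebraMap_injective (𝓞 K) (𝓞 L))]
    exact bot_le)
  exact ⟨Q, hQ, hQv⟩

theorem aux_numberfield (E : Type*) [Field E] [NumberField E] (B : ℕ) :
    ∃ l : ℕ, l.Prime ∧ B < l ∧ ∀ P : Ideal (𝓞 E), P.IsPrime → (l : 𝓞 E) ∈ P →
      ∀ x : 𝓞 E, ∃ m : ℤ, x - m ∈ P := by
  have : Algebra.IsAlgebraic ℚ (AlgebraicClosure E) := Algebra.IsAlgebraic.trans ℚ E _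
  have : IsAlgClosure ℚ (AlgebraicClosure E) := ⟨inferInstance, inferInstance⟩
  have : Normal ℚ (AlgebraicClosure E) := inferInstance
  let N := IntermediateField.normalClosure ℚ E (AlgebraicClosure E)
  have : NumberField N := { to_charZero := inferInstance, to_finiteDimensional := inferInstance }
  have hnorm : Normal ℚ N := by
    convert normalClosure.normal ℚ E (AlgebraicClosure E)
    exact Subsingleton.elim _ _
  have : IsGalois ℚ N := { to_isSeparable := inferInstance, to_normal := hnorm }
  obtain ⟨l, hl, hlB, h⟩ := aux_galois N B
  refine ⟨l, hl, hlB, fun P hP hlP x => ?_⟩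
  obtain ⟨P', hP', rfl⟩ := aux_descend E N P hP
  obtain ⟨m, hm⟩ := h P' hP' (by simpa using hlP) (algebraMap _ _ x)
  exact ⟨m, by simpa using hm⟩

theorem aux_mem_int {R : Type*} [CommRing R] {P : Ideal R} (hP : P.IsPrime) {l : ℕ} (hl : l.Prime)
    (hlP : (l : R) ∈ P) {m : ℤ} (hm : (m : R) ∈ P) : (l : ℤ) ∣ m := by
  by_contra h
  have := (Nat.prime_iff_prime_int.1 hl).irreducible.coprime_iff_not_dvd.2 h
  obtain ⟨a, b, hab⟩ := this
  have hab' : (a : R) * l + b * m = 1 := by exact_mod_cast congrArg (Int.cast (R := R)) hab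
  refine hP.ne_top ((Ideal.eq_top_iff_one _).2 (hab' ▸ ?_))
  exact P.add_mem (P.mul_mem_left _ hlP) (P.mul_mem_left _ hm)

open Polynomial in
/-- Production of the prime. -/
theorem aux_prime (k : Type*) [Field k] [NumberField k] (p M : ℕ) (hp : 0 < p) (hM : 0 < M)
    (α : 𝓞 k) (B : ℕ) :
    ∃ l : ℕ, l.Prime ∧ B < l ∧ M ∣ l - 1 ∧ ∀ v : Ideal (𝓞 k), v.IsPrime → (l : 𝓞 k) ∈ v →
      ∃ m : ℤ, (m : 𝓞 k) ^ p - α ∈ v := by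
  let f : k[X] := (X ^ p - C (α : k)) * cyclotomic M k
  let E := f.SplittingField
  have : CharZero E := charZero_of_injective_algebraMap (algebraMap k E).injective
  have : NumberField E := { to_charZero := inferInstance,
                            to_finiteDimensional := FiniteDimensional.trans ℚ k E }
  have hf0 : f ≠ 0 := mul_ne_zero (monic_X_pow_sub_C _ hp.ne').ne_zero (cyclotomic_ne_zero _ _)
  have hs : (f.map (algebraMap k E)).Splits := SplittingField.splits f
  have hfm : f.map (algebraMap k E) ≠ 0 := (Polynomial.map_ne_zero_iff (algebraMap k E).injective).2 hf0
  have hs1 : ((X ^ p - C (α : k)).map (algebraMap k E)).Splits :=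
    hs.of_dvd hfm (Polynomial.map_dvd _ (Dvd.intro _ rfl))
  have hs2 : ((cyclotomic M k).map (algebraMap k E)).Splits :=
    hs.of_dvd hfm (Polynomial.map_dvd _ (Dvd.intro_left _ rfl))
  obtain ⟨a, ha⟩ := hs1.exists_eval_eq_zero (by
    rw [degree_map, degree_X_pow_sub_C hp]; exact_mod_cast hp.ne')
  obtain ⟨ζ, hζ⟩ := hs2.exists_eval_eq_zero (by
    rw [degree_map, degree_cyclotomic]; exact_mod_cast (Nat.totient_pos.2 hM).ne')
  have ha' : a ^ p = algebraMap k E α := by simpa [sub_eq_zero] using ha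
  rw [map_cyclotomic] at hζ
  have hζ' : IsPrimitiveRoot ζ M := (isRoot_cyclotomic_iff_charZero hM).1 hζ
  have haint : IsIntegral ℤ a := by
    refine IsIntegral.of_pow hp ?_
    rw [ha']
    exact α.isIntegral_coe.algebraMap
  let a' : 𝓞 E := ⟨a, haint⟩
  let z : 𝓞 E := ⟨ζ, hζ'.isIntegral hM⟩
  have hz : (cyclotomic M (𝓞 E)).eval z = 0 := by
    have : IsPrimitiveRoot z M :=
      IsPrimitiveRoot.of_map_of_injective (f := algebraMap (𝓞 E) E) hζ' RingOfIntegers.coe_injective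
    exact (isRoot_cyclotomic_iff_charZero hM).2 this
  have ha2 : a' ^ p = algebraMap (𝓞 k) (𝓞 E) α := RingOfIntegers.coe_injective ha'
  obtain ⟨l, hl, hlB, h⟩ := aux_numberfield E (max B M)
  refine ⟨l, hl, (le_max_left _ _).trans_lt hlB, ?_, ?_⟩
  · obtain ⟨P, hPm, hlP⟩ : ∃ P : Ideal (𝓞 E), P.IsMaximal ∧ (l : 𝓞 E) ∈ P := by
      apply exists_max_ideal_of_mem_nonunits
      intro hu
      have h1 := hu.map (Algebra.norm ℤ)
      have h2 : Algebra.norm ℤ (l : 𝓞 E) = (l : ℤ) ^ Module.finrank ℤ (𝓞 E) := by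
        have := Algebra.norm_algebraMap_of_basis (Module.Free.chooseBasis ℤ (𝓞 E)) (l : ℤ)
        rw [Module.finrank_eq_card_chooseBasisIndex, ← this]
        simp
      rw [h2, isUnit_pow_iff Module.finrank_pos.ne'] at h1
      exact (Nat.prime_iff_prime_int.1 hl).not_isUnit h1
    obtain ⟨m, hm⟩ := h P hPm.isPrime hlP z
    have hd := sub_dvd_eval_sub z (m : 𝓞 E) (cyclotomic M (𝓞 E))
    have hm2 := P.mem_of_dvd hd hm
    rw [hz, zero_sub, neg_mem_iff, ← map_cyclotomic_int, eval_intCast_map] at hm2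
    have hm3 := aux_mem_int hPm.isPrime hl hlP (by simpa using hm2)
    have := Fact.mk hl
    have hroot : IsRoot (cyclotomic M (ZMod l)) (m : ZMod l) := by
      rw [IsRoot.def, ← map_cyclotomic_int, eval_intCast_map]
      simpa using (ZMod.intCast_zmod_eq_zero_iff_dvd _ _).2 hm3
    have : NeZero (M : ZMod l) := ⟨by
      rw [Ne, ZMod.natCast_eq_zero_iff]
      intro h
      exact absurd (Nat.le_of_dvd hM h) (not_le.2 ((le_max_right _ _).trans_lt hlB))⟩
    have hpr := isRoot_cyclotomic_iff.1 hroot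
    apply hpr.dvd_of_pow_eq_one
    exact ZMod.pow_card_sub_one_eq_one (hpr.isUnit hM.ne').ne_zero
  · intro v hv hlv
    obtain ⟨P, hP, rfl⟩ := aux_descend k E v hv
    obtain ⟨m, hm⟩ := h P hP (by simpa using hlv) a'
    refine ⟨m, ?_⟩
    rw [Ideal.mem_comap, map_sub, map_pow, map_intCast, ← ha2]
    refine P.mem_of_dvd (sub_dvd_pow_sub_pow _ _ p) ?_
    rw [← neg_sub]
    exact P.neg_mem hm

theorem aux_mem_max (k : Type*) [Field k] [NumberField k] (v : HeightOneSpectrum (𝓞 k)) (r : 𝓞 k) :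
    IsUnit (algebraMap (𝓞 k) (v.adicCompletionIntegers k) r) ↔ r ∉ v.asIdeal := by
  rw [HeightOneSpectrum.adicCompletionIntegers.isUnit_iff_valued_eq_one,
    HeightOneSpectrum.algebraMap_adicCompletionIntegers_apply,
    HeightOneSpectrum.valuedAdicCompletion_eq_valuation',
    HeightOneSpectrum.valuation_eq_one_iff_notMem]

theorem exists_auxiliary_beta (k : Type*) [Field k] [NumberField k]
    (p q : ℕ) (hp : 0 < p) (hq : 0 < q) (α : 𝓞 k) (hα : α ≠ 0) :
    ∃ β : ℤ, β ≠ 0 ∧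
      (∀ v : HeightOneSpectrum (𝓞 k), ¬(α ∈ v.asIdeal ∧ (β : 𝓞 k) ∈ v.asIdeal)) ∧
      (∃ v : HeightOneSpectrum (𝓞 k), (β : 𝓞 k) ∈ v.asIdeal ∧ (β : 𝓞 k) ∉ v.asIdeal ^ 2) ∧
      (∀ v : HeightOneSpectrum (𝓞 k), α * (q : 𝓞 k) ∈ v.asIdeal →
        ∃ y : v.adicCompletion k, y ^ q = algebraMap k (v.adicCompletion k) ((β : ℤ) : k)) ∧
      (∀ v : HeightOneSpectrum (𝓞 k), (β : 𝓞 k) ∈ v.asIdeal →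
        ∃ y : v.adicCompletion k, y ^ p =
          algebraMap k (v.adicCompletion k) (algebraMap (𝓞 k) k α)) := by
  let n := Ideal.absNorm (Ideal.span {α})
  have hn0 : 0 < n := Nat.pos_of_ne_zero (by
    rw [Ne, Ideal.absNorm_eq_zero_iff, Ideal.span_singleton_eq_bot]; exact hα)
  have hn : ∀ v : Ideal (𝓞 k), α ∈ v → (n : 𝓞 k) ∈ v := fun v hv =>
    (Ideal.span_singleton_le_iff_mem _).2 hv (Ideal.absNorm_mem _)
  obtain ⟨l, hl, hlB, hM, hroot⟩ := aux_prime k p (q ^ 2 * (q * n)) hp (by positivity) α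
    (max p (discr k).natAbs)
  obtain ⟨t, ht⟩ := hM
  have hl1 : l = 1 + q ^ 2 * (q * n * t) := by
    have := hl.one_lt
    rw [← mul_assoc, ← ht]; omega
  have hlk : (l : 𝓞 k) = 1 + (q : 𝓞 k) ^ 2 * (q * n * t) := by
    exact_mod_cast congrArg (Nat.cast (R := 𝓞 k)) hl1
  have hone : ∀ v : HeightOneSpectrum (𝓞 k), ¬ (α ∈ v.asIdeal ∧ (l : 𝓞 k) ∈ v.asIdeal) := by
    rintro v ⟨h1, h2⟩
    refine v.isPrime.ne_top ((Ideal.eq_top_iff_one _).2 ?_)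
    have h3 : (1 : 𝓞 k) = l - (q ^ 2 * q * t) * n := by rw [hlk]; ring
    rw [h3]
    exact Ideal.sub_mem _ h2 (Ideal.mul_mem_left _ _ (hn _ h1))
  refine ⟨l, by exact_mod_cast hl.ne_zero, ?_, ?_, ?_, ?_⟩
  · simpa using hone
  · obtain ⟨P, hPm, hlP⟩ : ∃ P : Ideal (𝓞 k), P.IsMaximal ∧ (l : 𝓞 k) ∈ P := by
      apply exists_max_ideal_of_mem_nonunits
      intro hu
      have h1 := hu.map (Algebra.norm ℤ)
      have h2 : Algebra.norm ℤ (l : 𝓞 k) = (l : ℤ) ^ Module.finrank ℤ (𝓞 k) := by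
        have := Algebra.norm_algebraMap_of_basis (Module.Free.chooseBasis ℤ (𝓞 k)) (l : ℤ)
        rw [Module.finrank_eq_card_chooseBasisIndex, ← this]
        simp
      rw [h2, isUnit_pow_iff Module.finrank_pos.ne'] at h1
      exact (Nat.prime_iff_prime_int.1 hl).not_isUnit h1
    have hPbot : P ≠ ⊥ := by
      rintro rfl
      rw [Ideal.mem_bot] at hlP
      exact hl.ne_zero (by exact_mod_cast hlP)
    refine ⟨⟨P, hPm.isPrime, hPbot⟩, by simpa using hlP, ?_⟩
    have hpi := Nat.prime_iff_prime_int.1 hl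
    have hnd : ¬ (l : ℤ) ∣ discr k := by
      rw [Int.natCast_dvd]
      intro h
      exact absurd (Nat.le_of_dvd (Int.natAbs_pos.2 (discr_ne_zero k)) h)
        (not_le.2 ((le_max_right _ _).trans_lt hlB))
    have hun := (NumberField.not_dvd_discr_iff_forall_mem k (𝓞 k) hpi).1 hnd P hPm.isPrime
      (by simpa using hlP)
    intro hmem
    have : (Ideal.span {(l : ℤ)}).IsMaximal :=
      PrincipalIdealRing.isMaximal_of_irreducible hpi.irreducible
    have hdvd := pow_sub_one_dvd_differentIdeal ℤ P 2 (p := Ideal.span {(l : ℤ)}) (by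
      simpa using hl.ne_zero) (by
      rw [Ideal.dvd_iff_le, Ideal.map_span, Ideal.span_le]
      simpa using hmem)
    rw [show 2 - 1 = 1 from rfl, pow_one] at hdvd
    exact (not_dvd_differentIdeal_iff (A := ℤ) (B := 𝓞 k) (P := P)).2 hun hdvd
  · intro v hv
    have := aux_hens k v
    have hs : (q * n * t : 𝓞 k) ∈ v.asIdeal := by
      refine Ideal.mul_mem_right _ _ ?_
      rcases v.isPrime.mem_or_mem hv with h | h
      · exact Ideal.mul_mem_left _ _ (hn _ h)
      · exact Ideal.mul_mem_right _ _ h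
    obtain ⟨y, hy⟩ := aux_qth_power (R := v.adicCompletionIntegers k) q hq
      (algebraMap (𝓞 k) _ (q * n * t)) (by
        rw [IsLocalRing.mem_maximalIdeal, mem_nonunits_iff, aux_mem_max]
        exact not_not.2 hs)
    refine ⟨y, ?_⟩
    have h1 : y ^ q = algebraMap (𝓞 k) _ (l : 𝓞 k) := by
      rw [hy, hlk]; simp
    have h2 := congrArg (Subtype.val) h1
    rw [HeightOneSpectrum.algebraMap_adicCompletionIntegers_apply] at h2
    rw [← SubmonoidClass.coe_pow, h2, HeightOneSpectrum.algebraMap_adicCompletion]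
    simp
  · intro v hv
    have := aux_hens k v
    have hlv : (l : 𝓞 k) ∈ v.asIdeal := by simpa using hv
    obtain ⟨m, hm⟩ := hroot v.asIdeal v.isPrime hlv
    have hpv : (p : 𝓞 k) ∉ v.asIdeal := by
      intro h
      have := aux_mem_int v.isPrime hl hlv (m := p) (by simpa using h)
      exact absurd (Nat.le_of_dvd hp (by exact_mod_cast this))
        (not_le.2 ((le_max_left _ _).trans_lt hlB))
    have hαv : α ∉ v.asIdeal := fun h => hone v ⟨h, hlv⟩
    obtain ⟨y, hy⟩ := aux_pth_power (R := v.adicCompletionIntegers k) p hp (by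
        simpa using (aux_mem_max k v p).2 hpv) (algebraMap (𝓞 k) _ α) (algebraMap (𝓞 k) _ m)
        ((aux_mem_max k v α).2 hαv) (by
        rw [← map_pow, ← map_sub, IsLocalRing.mem_maximalIdeal, mem_nonunits_iff, aux_mem_max]
        exact not_not.2 hm)
    refine ⟨y, ?_⟩
    have h2 := congrArg (Subtype.val) hy
    rw [HeightOneSpectrum.algebraMap_adicCompletionIntegers_apply] at h2
    rw [← SubmonoidClass.coe_pow, h2, HeightOneSpectrum.algebraMap_adicCompletion]
    simp
end

section
/- Let p be a prime with p ≡ 1 (mod 8). Then the diagonal surface x₀⁴ + 4x₁⁴ − p²x₂⁴ − 4p²x₃⁴ = 0 of degree 4 over ℚ contains a line over ℝ and over the field ℚ_ℓ of ℓ-adic numbers for every prime ℓ, but contains no line over ℚ. -/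
open MvPolynomial

/-- The diagonal surface `∑ aᵢ xᵢ^d = 0` contains a line over the field `K`. -/
def ContainsLine (K : Type*) [Field K] (d : ℕ) (a : Fin 4 → K) : Prop :=
  ∃ l₁ l₂ : MvPolynomial (Fin 4) K,
    l₁.IsHomogeneous 1 ∧ l₂.IsHomogeneous 1 ∧
    LinearIndependent K ![l₁, l₂] ∧
    (∑ i : Fin 4, C (a i) * X i ^ d) ∈ Ideal.span {l₁, l₂}


lemma homog_aux {K : Type*} [Field K] (c : K) (i j : Fin 4) :
    (X i - C c * X j : MvPolynomial (Fin 4) K).IsHomogeneous 1 := by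
  have h : (C c * X j : MvPolynomial (Fin 4) K).IsHomogeneous (0 + 1) :=
    (isHomogeneous_C _ c).mul (isHomogeneous_X _ j)
  rw [zero_add] at h
  exact (isHomogeneous_X _ i).sub h

/-- A square root of `-1` gives a line. -/
lemma line_of_sq_neg_one {K : Type*} [Field K] (a : Fin 4 → K) (q i : K) (hi : i ^ 2 = -1)
    (h0 : a 0 = 1) (h1 : a 1 = 4) (h2 : a 2 = - q ^ 2) (h3 : a 3 = -4 * q ^ 2) :
    ContainsLine K 4 a := by
  refine ⟨X 0 - C (1 + i) * X 1, X 2 - C (1 + i) * X 3, ?_, ?_, ?_, ?_⟩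
  · exact homog_aux _ _ _
  · exact homog_aux _ _ _
  · rw [LinearIndependent.pair_iff]
    intro s t h
    have e0 := congrArg (eval (Pi.single 0 1 : Fin 4 → K)) h
    have e2 := congrArg (eval (Pi.single 2 1 : Fin 4 → K)) h
    simp [smul_eval, Pi.single_apply] at e0 e2
    exact ⟨e0, e2⟩
  · rw [Ideal.mem_span_pair]
    have hc : (C (1 + i) : MvPolynomial (Fin 4) K) ^ 4 = -4 := by
      rw [← C_pow, show (1 + i) ^ 4 = -4 by linear_combination (i ^ 2 + 4 * i + 5) * hi, C_neg, map_ofNat]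
    refine ⟨(X 0 + C (1 + i) * X 1) * (X 0 ^ 2 + (C (1 + i) * X 1) ^ 2),
      - C q ^ 2 * ((X 2 + C (1 + i) * X 3) * (X 2 ^ 2 + (C (1 + i) * X 3) ^ 2)), ?_⟩
    simp only [Fin.sum_univ_four, h0, h1, h2, h3, C_mul, C_neg, C_pow, C_1, map_ofNat]
    linear_combination (- X 1 ^ 4 + C q ^ 2 * X 3 ^ 4) * hc

lemma line_of_fourth_root {K : Type*} [Field K] (a : Fin 4 → K) (q r : K) (hr : r ^ 4 = q ^ 2)
    (h0 : a 0 = 1) (h1 : a 1 = 4) (h2 : a 2 = - q ^ 2) (h3 : a 3 = -4 * q ^ 2) :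
    ContainsLine K 4 a := by
  refine ⟨X 0 - C r * X 2, X 1 - C r * X 3, ?_, ?_, ?_, ?_⟩
  · exact homog_aux _ _ _
  · exact homog_aux _ _ _
  · rw [LinearIndependent.pair_iff]
    intro s t h
    have e0 := congrArg (eval (Pi.single 0 1 : Fin 4 → K)) h
    have e2 := congrArg (eval (Pi.single 1 1 : Fin 4 → K)) h
    simp [smul_eval, Pi.single_apply] at e0 e2
    exact ⟨e0, e2⟩
  · rw [Ideal.mem_span_pair]
    have hc : (C r : MvPolynomial (Fin 4) K) ^ 4 = C q ^ 2 := by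
      rw [← C_pow, hr, C_pow]
    refine ⟨(X 0 + C r * X 2) * (X 0 ^ 2 + (C r * X 2) ^ 2),
      4 * ((X 1 + C r * X 3) * (X 1 ^ 2 + (C r * X 3) ^ 2)), ?_⟩
    simp only [Fin.sum_univ_four, h0, h1, h2, h3, C_mul, C_neg, C_pow, C_1, map_ofNat]
    linear_combination (- X 2 ^ 4 - 4 * X 3 ^ 4) * hc

lemma padic_sq_of_hensel (ℓ : ℕ) [Fact ℓ.Prime] (n a : ℤ)
    (h : ‖((a ^ 2 - n : ℤ) : ℤ_[ℓ])‖ < ‖((2 * a : ℤ) : ℤ_[ℓ])‖ ^ 2) :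
    ∃ r : ℚ_[ℓ], r ^ 2 = n := by
  obtain ⟨z, hz, -⟩ := hensels_lemma (p := ℓ) (R := ℤ)
    (F := (Polynomial.X ^ 2 - Polynomial.C n : Polynomial ℤ)) (a := (a : ℤ_[ℓ]))
    (by
      have h2 : (Polynomial.aeval (a : ℤ_[ℓ])) (2 : Polynomial ℤ) = 2 := map_ofNat _ 2
      simpa [h2] using h)
  refine ⟨(z : ℚ_[ℓ]), ?_⟩
  simp only [map_sub, map_pow, Polynomial.aeval_X, Polynomial.aeval_C, sub_eq_zero] at hz
  have := congrArg (fun w : ℤ_[ℓ] => (w : ℚ_[ℓ])) hz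
  simpa using this

lemma padic_sq_of_mod (ℓ : ℕ) [Fact ℓ.Prime] (hℓ : ℓ ≠ 2) (n : ℤ) (hn : (n : ZMod ℓ) ≠ 0)
    (h : IsSquare (n : ZMod ℓ)) : ∃ r : ℚ_[ℓ], r ^ 2 = n := by
  obtain ⟨b, hb⟩ := h
  obtain ⟨a, rfl⟩ := ZMod.intCast_surjective b
  apply padic_sq_of_hensel ℓ n a
  have h1 : ‖((a ^ 2 - n : ℤ) : ℤ_[ℓ])‖ < 1 := by
    rw [PadicInt.norm_int_lt_one_iff_dvd, ← ZMod.intCast_zmod_eq_zero_iff_dvd]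
    push_cast
    rw [hb]; ring
  have h2 : ‖((2 * a : ℤ) : ℤ_[ℓ])‖ = 1 := by
    refine le_antisymm (PadicInt.norm_le_one _) (not_lt.mp ?_)
    rw [PadicInt.norm_int_lt_one_iff_dvd, ← ZMod.intCast_zmod_eq_zero_iff_dvd]
    push_cast
    intro h0
    rcases mul_eq_zero.mp h0 with h0 | h0
    · exact Ring.two_ne_zero (by rw [ZMod.ringChar_zmod_n]; exact hℓ) h0
    · rw [h0] at hb; exact hn (by simpa using hb)
  rw [h2]; simpa using h1

lemma padic_cases (p : ℕ) (hp : p.Prime) (hp8 : p % 8 = 1) (ℓ : ℕ) [Fact ℓ.Prime] :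
    (∃ i : ℚ_[ℓ], i ^ 2 = -1) ∨ ∃ r : ℚ_[ℓ], r ^ 4 = (p : ℚ_[ℓ]) ^ 2 := by
  by_cases h2 : ℓ = 2
  · right
    subst h2
    obtain ⟨r, hr⟩ := padic_sq_of_hensel 2 p 1 (by
      have h1 : ‖((1 ^ 2 - p : ℤ) : ℤ_[2])‖ ≤ ((2 : ℕ) : ℝ) ^ (-(3 : ℕ) : ℤ) := by
        rw [PadicInt.norm_int_le_pow_iff_dvd]
        norm_num
        omega
      have h3 : ‖((2 * 1 : ℤ) : ℤ_[2])‖ = 2⁻¹ := by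
        have := PadicInt.norm_p (p := 2)
        simpa using this
      rw [h3]
      refine lt_of_le_of_lt h1 ?_
      norm_num)
    exact ⟨r, by rw [show r ^ 4 = (r ^ 2) ^ 2 by ring, hr]; simp⟩
  by_cases h3 : ℓ % 4 = 3
  · right
    have hlp : ℓ ≠ p := by omega
    have hp0 : (p : ZMod ℓ) ≠ 0 := by
      rw [Ne, ZMod.natCast_eq_zero_iff, Nat.prime_dvd_prime_iff_eq Fact.out hp]
      exact hlp
    by_cases hs : IsSquare (p : ZMod ℓ)
    · obtain ⟨r, hr⟩ := padic_sq_of_mod ℓ h2 p (by simpa using hp0) (by simpa using hs)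
      exact ⟨r, by rw [show r ^ 4 = (r ^ 2) ^ 2 by ring, hr]; simp⟩
    · have hm : IsSquare (-(p : ZMod ℓ)) := by
        have hn1 : ¬ IsSquare (-1 : ZMod ℓ) := by
          rw [ZMod.exists_sq_eq_neg_one_iff]; simpa using h3
        have hr : ringChar (ZMod ℓ) ≠ 2 := by rwa [ZMod.ringChar_zmod_n]
        rw [← quadraticChar_neg_one_iff_not_isSquare] at hs hn1
        rw [← quadraticChar_one_iff_isSquare (neg_ne_zero.mpr hp0), neg_eq_neg_one_mul, map_mul,
          hs, hn1]
        norm_num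
      obtain ⟨r, hr⟩ := padic_sq_of_mod ℓ h2 (-p) (by simpa using hp0) (by simpa using hm)
      exact ⟨r, by rw [show r ^ 4 = (r ^ 2) ^ 2 by ring, hr]; simp⟩
  · left
    obtain ⟨r, hr⟩ := padic_sq_of_mod ℓ h2 (-1) (by simp)
      (by push_cast; exact ZMod.exists_sq_eq_neg_one_iff.mpr h3)
    exact ⟨r, by rw [hr]; simp⟩

lemma linear_of_homogeneous {K : Type*} [Field K] (l : MvPolynomial (Fin 4) K)
    (hl : l.IsHomogeneous 1) : ∃ f : (Fin 4 → K) →ₗ[K] K, ∀ x, eval x l = f x := by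
  rw [← mem_homogeneousSubmodule, homogeneousSubmodule_one_eq_span_X] at hl
  induction hl using Submodule.span_induction with
  | mem x h =>
    obtain ⟨i, rfl⟩ := h
    exact ⟨LinearMap.proj i, fun x => by simp⟩
  | zero => exact ⟨0, fun x => by simp⟩
  | add x y _ _ hx hy =>
    obtain ⟨f, hf⟩ := hx
    obtain ⟨g, hg⟩ := hy
    exact ⟨f + g, fun x => by simp [hf, hg]⟩
  | smul c x _ hx =>
    obtain ⟨f, hf⟩ := hx
    exact ⟨c • f, fun x => by simp [hf, smul_eval]⟩

lemma no_rational_line (p : ℕ) (hp : p.Prime) (hp8 : p % 8 = 1) :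
    ¬ContainsLine ℚ 4 ![1, 4, -(p : ℚ) ^ 2, -4 * (p : ℚ) ^ 2] := by
  rintro ⟨l₁, l₂, h1, h2, -, hF⟩
  obtain ⟨f, hf⟩ := linear_of_homogeneous l₁ h1
  obtain ⟨g, hg⟩ := linear_of_homogeneous l₂ h2
  have hp0 : (p : ℚ) ≠ 0 := by exact_mod_cast hp.ne_zero
  have key : ∀ x : Fin 4 → ℚ, f x = 0 → g x = 0 →
      x 0 ^ 4 + 4 * x 1 ^ 4 = p ^ 2 * (x 2 ^ 4 + 4 * x 3 ^ 4) := by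
    intro x hx hy
    obtain ⟨A, B, hAB⟩ := Ideal.mem_span_pair.mp hF
    have := congrArg (eval x) hAB
    simp [hf, hg, hx, hy, Fin.sum_univ_four] at this
    linear_combination -this
  let Φ : (Fin 4 → ℚ) →ₗ[ℚ] (Fin 4 → ℚ) :=
    LinearMap.pi ![f, g, LinearMap.proj 0, LinearMap.proj 1]
  have hinj : Function.Injective Φ := by
    rw [injective_iff_map_eq_zero]
    intro x hx
    have e0 : f x = 0 := by simpa [Φ] using congrFun hx 0
    have e1 : g x = 0 := by simpa [Φ] using congrFun hx 1
    have e2 : x 0 = 0 := by simpa [Φ] using congrFun hx 2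
    have e3 : x 1 = 0 := by simpa [Φ] using congrFun hx 3
    have k := key x e0 e1
    rw [e2, e3] at k
    have k' : x 2 ^ 4 + 4 * x 3 ^ 4 = 0 := by
      have : (p : ℚ) ^ 2 * (x 2 ^ 4 + 4 * x 3 ^ 4) = 0 := by rw [← k]; norm_num
      exact (mul_eq_zero.mp this).resolve_left (pow_ne_zero _ hp0)
    have p2 : 0 ≤ x 2 ^ 4 := by positivity
    have p3 : 0 ≤ x 3 ^ 4 := by positivity
    have z2 : x 2 = 0 := pow_eq_zero_iff (n := 4) (by norm_num) |>.mp (by linarith)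
    have z3 : x 3 = 0 := pow_eq_zero_iff (n := 4) (by norm_num) |>.mp (by linarith)
    ext i
    fin_cases i <;> simp [e2, e3, z2, z3]
  have hsurj := LinearMap.injective_iff_surjective.mp hinj
  obtain ⟨u, hu⟩ := hsurj ![0, 0, 1, 0]
  obtain ⟨v, hv⟩ := hsurj ![0, 0, 0, 1]
  have u0 : f u = 0 := by simpa [Φ] using congrFun hu 0
  have u1 : g u = 0 := by simpa [Φ] using congrFun hu 1
  have u2 : u 0 = 1 := by simpa [Φ] using congrFun hu 2
  have u3 : u 1 = 0 := by simpa [Φ] using congrFun hu 3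
  have v0 : f v = 0 := by simpa [Φ] using congrFun hv 0
  have v1 : g v = 0 := by simpa [Φ] using congrFun hv 1
  have v2 : v 0 = 0 := by simpa [Φ] using congrFun hv 2
  have v3 : v 1 = 1 := by simpa [Φ] using congrFun hv 3
  have K : ∀ s t : ℚ, s ^ 4 + 4 * t ^ 4 =
      p ^ 2 * ((s * u 2 + t * v 2) ^ 4 + 4 * (s * u 3 + t * v 3) ^ 4) := by
    intro s t
    have := key (s • u + t • v) (by simp [u0, v0]) (by simp [u1, v1])
    simpa [u2, u3, v2, v3] using this
  generalize u 2 = a at K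
  generalize u 3 = b at K
  generalize v 2 = c at K
  generalize v 3 = d at K
  have E1 : 1 = (p : ℚ) ^ 2 * (a ^ 4 + 4 * b ^ 4) := by
    linear_combination K 1 0
  have E2 : 4 = (p : ℚ) ^ 2 * (c ^ 4 + 4 * d ^ 4) := by
    linear_combination K 0 1
  have E3 : (p : ℚ) ^ 2 * ((a * c) ^ 2 + 4 * (b * d) ^ 2) = 0 := by
    linear_combination (-1 / 12) * (K 1 1 + K 1 (-1) - 2 * K 1 0 - 2 * K 0 1)
  have E4 := (mul_eq_zero.mp E3).resolve_left (pow_ne_zero _ hp0)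
  have ac : a * c = 0 := by nlinarith [sq_nonneg (a * c), sq_nonneg (b * d)]
  have bd : b * d = 0 := by nlinarith [sq_nonneg (a * c), sq_nonneg (b * d)]
  have hpos : (0 : ℚ) < p := by exact_mod_cast hp.pos
  have C1 : ¬ (1 = (p : ℚ) ^ 2 * a ^ 4) := by
    intro h
    have h' : (p : ℚ) * a ^ 2 = 1 := by
      have : 0 ≤ (p : ℚ) * a ^ 2 := by positivity
      rw [← pow_left_inj₀ this zero_le_one (n := 2) (by norm_num)]
      linear_combination -h
    have : IsSquare (p : ℚ) := ⟨p * a, by linear_combination -(p : ℚ) * h'⟩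
    rw [Rat.isSquare_natCast_iff] at this
    exact hp.prime.irreducible.not_isSquare this
  have C2 : ¬ (1 = (p : ℚ) ^ 2 * (4 * b ^ 4)) := by
    intro h
    have h' : 2 * (p : ℚ) * b ^ 2 = 1 := by
      have : 0 ≤ 2 * (p : ℚ) * b ^ 2 := by positivity
      rw [← pow_left_inj₀ this zero_le_one (n := 2) (by norm_num)]
      linear_combination -h
    have : IsSquare ((2 * p : ℕ) : ℚ) :=
      ⟨2 * p * b, by push_cast; linear_combination -(2 * p : ℚ) * h'⟩
    rw [Rat.isSquare_natCast_iff] at this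
    obtain ⟨k, hk⟩ := this
    have hpk : p ∣ k := by
      have : p ∣ k * k := ⟨2, by rw [← hk]; ring⟩
      rcases hp.dvd_mul.mp this with h | h <;> exact h
    obtain ⟨m, rfl⟩ := hpk
    have : 2 = p * (m * m) := Nat.eq_of_mul_eq_mul_left hp.pos (by linarith)
    have : p ∣ 2 := ⟨_, this⟩
    have := Nat.le_of_dvd (by norm_num) this
    have := hp.two_le
    omega
  rcases mul_eq_zero.mp ac with rfl | rfl
  · exact C2 (by linear_combination E1)
  · rcases mul_eq_zero.mp bd with rfl | rfl
    · exact C1 (by linear_combination E1)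
    · norm_num at E2

/-- For a prime `p ≡ 1 (mod 8)`, the quartic diagonal surface
`x₀⁴ + 4x₁⁴ − p²x₂⁴ − 4p²x₃⁴ = 0` contains a line over `ℝ` and over `ℚ_ℓ` for every prime `ℓ`,
but contains no line over `ℚ`. -/
theorem quartic_counterexample (p : ℕ) (hp : p.Prime) (hp8 : p % 8 = 1) :
    ContainsLine ℝ 4
      (fun i => algebraMap ℚ ℝ (![1, 4, -(p : ℚ) ^ 2, -4 * (p : ℚ) ^ 2] i)) ∧
    (∀ (ℓ : ℕ) (_ : Fact ℓ.Prime),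
      ContainsLine ℚ_[ℓ] 4
        (fun i => algebraMap ℚ ℚ_[ℓ] (![1, 4, -(p : ℚ) ^ 2, -4 * (p : ℚ) ^ 2] i))) ∧
    ¬ContainsLine ℚ 4 ![1, 4, -(p : ℚ) ^ 2, -4 * (p : ℚ) ^ 2] := by
  refine ⟨?_, ?_, no_rational_line p hp hp8⟩
  · refine line_of_fourth_root _ (p : ℝ) (√(p : ℝ)) ?_ ?_ ?_ ?_ ?_
    · rw [show √(p : ℝ) ^ 4 = (√(p : ℝ) ^ 2) ^ 2 by ring, Real.sq_sqrt (Nat.cast_nonneg p)]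
    all_goals simp
  · intro ℓ hℓ
    rcases padic_cases p hp hp8 ℓ with ⟨i, hi⟩ | ⟨r, hr⟩
    · refine line_of_sq_neg_one _ (p : ℚ_[ℓ]) i hi ?_ ?_ ?_ ?_
      all_goals simp
    · refine line_of_fourth_root _ (p : ℚ_[ℓ]) r hr ?_ ?_ ?_ ?_
      all_goals simp
end
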